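/- arXiv:2212.12692 — 2 statements merged into one kernel-verified Lean document; each statement's English description precedes it below -/
import Mathlib

section
/- Let α ∈ (0,1), a < b reals, B a real d×N matrix, and let Φ : [a,b) → ℝ^{d×d} be a function such that the map t ↦ (b−t)^{1−α} Φ(t) extends to a continuous function on the closed interval [a,b]. Define the controllability Gramian W = ∫_a^b (b−t)^{1−α} Φ(t) B Bᵀ Φ(t)ᵀ dt. Then the following are equivalent: (1) for every w ∈ ℝ^d there exists a continuous control u : [a,b] → ℝ^N with ∫_a^b Φ(t) B u(t) dt = w; (2) the d×d matrix W is invertible. -/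
open MeasureTheory Set Matrix

attribute [local instance] Matrix.normedAddCommGroup Matrix.normedSpace

/-- The weakly singular kernel `(b - t) ^ (α - 1)` is integrable on `[a, b]`. -/
theorem intervalIntegrable_sub_rpow {α a b : ℝ} (hα : 0 < α) :
    IntervalIntegrable (fun t => (b - t) ^ (α - 1)) volume a b := by
  have h : IntervalIntegrable (fun t : ℝ => t ^ (α - 1)) volume (b - a) 0 :=
    intervalIntegral.intervalIntegrable_rpow' (by linarith)
  simpa using h.comp_sub_left b

/-- Two functions that agree on `[a, b)` agree almost everywhere on `(a, b]`. -/
theorem ae_eq_of_eqOn_Ico {E : Type*} {a b : ℝ} {f g : ℝ → E}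
    (h : ∀ t ∈ Set.Ico a b, f t = g t) : f =ᵐ[volume.restrict (Set.Ioc a b)] g := by
  rw [Filter.EventuallyEq, ae_restrict_iff' measurableSet_Ioc]
  filter_upwards [Measure.ae_ne volume b] with t hb ht
  exact h t ⟨ht.1.le, lt_of_le_of_ne ht.2 hb⟩

/-- A function that agrees on `[a, b)` with a continuous function times `(b - t) ^ (α - 1)` is
integrable. -/
theorem intervalIntegrable_of_eqOn_rpow_smul {E : Type*} [NormedAddCommGroup E] [NormedSpace ℝ E]
    {α a b : ℝ} (hα : 0 < α) (hab : a < b) {f g : ℝ → E} (hg : ContinuousOn g (Set.Icc a b))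
    (h : ∀ t ∈ Set.Ico a b, f t = (b - t) ^ (α - 1) • g t) :
    IntervalIntegrable f volume a b := by
  have hk : IntervalIntegrable (fun t => (b - t) ^ (α - 1) • g t) volume a b :=
    (intervalIntegrable_sub_rpow hα).smul_continuousOn (by rwa [uIcc_of_le hab.le])
  refine hk.congr_ae ?_
  rw [uIoc_of_le hab.le]
  exact (ae_eq_of_eqOn_Ico h).symm

theorem dotProduct_gram_mulVec {m n : Type*} [Fintype m] [Fintype n] (M : Matrix m n ℝ)
    (x : m → ℝ) : x ⬝ᵥ ((M * Mᵀ) *ᵥ x) = (Mᵀ *ᵥ x) ⬝ᵥ (Mᵀ *ᵥ x) := by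
  rw [← mulVec_mulVec, dotProduct_mulVec, ← mulVec_transpose]

/-- Controllability is equivalent to invertibility of the controllability
Gramian `W = ∫_a^b (b-t)^{1-α} Φ(t) B Bᵀ Φ(t)ᵀ dt`. -/
theorem controllability_iff_gramian_invertible
    (d N : ℕ) (α a b : ℝ) (hα : α ∈ Set.Ioo (0:ℝ) 1) (hab : a < b)
    (B : Matrix (Fin d) (Fin N) ℝ)
    (Φ : ℝ → Matrix (Fin d) (Fin d) ℝ)
    (Φe : ℝ → Matrix (Fin d) (Fin d) ℝ) (hΦe : ContinuousOn Φe (Set.Icc a b))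
    (hext : ∀ t ∈ Set.Ico a b, Φe t = (b - t) ^ (1 - α) • Φ t) :
    (∀ w : EuclideanSpace ℝ (Fin d), ∃ u : ℝ → EuclideanSpace ℝ (Fin N),
        ContinuousOn u (Set.Icc a b) ∧
        (∫ t in a..b, Matrix.toEuclideanLin (Φ t * B) (u t)) = w)
    ↔ IsUnit (∫ t in a..b, (b - t) ^ (1 - α) • (Φ t * B * Bᵀ * (Φ t)ᵀ)) := by
  have hΦ : ∀ t ∈ Set.Ico a b, Φ t = (b - t) ^ (α - 1) • Φe t := by
    intro t ht
    have hpos : 0 < b - t := sub_pos.2 ht.2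
    rw [hext t ht, smul_smul, ← Real.rpow_add hpos]
    simp
  set F : ℝ → Matrix (Fin d) (Fin d) ℝ :=
    fun t => (b - t) ^ (1 - α) • (Φ t * B * Bᵀ * (Φ t)ᵀ) with hF
  have hgram : ∀ t, F t = (b - t) ^ (1 - α) • ((Φ t * B) * (Φ t * B)ᵀ) := fun t => by
    simp only [hF, transpose_mul, Matrix.mul_assoc]
  have hGcont : ContinuousOn (fun t => Φe t * B * Bᵀ * (Φe t)ᵀ) (Set.Icc a b) := by
    rw [continuousOn_iff_continuous_domRestrict] at hΦe ⊢
    exact ((hΦe.matrix_mul continuous_const).matrix_mul continuous_const).matrix_mul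
      hΦe.matrix_transpose
  have hFG : ∀ t ∈ Set.Ico a b, F t = (b - t) ^ (α - 1) • (Φe t * B * Bᵀ * (Φe t)ᵀ) := by
    intro t ht
    have hpos : 0 < b - t := sub_pos.2 ht.2
    simp only [hF, hext t ht, transpose_smul, Matrix.smul_mul, Matrix.mul_smul, smul_smul]
    rw [← Real.rpow_add hpos, ← Real.rpow_add hpos]
    congr 2; ring
  have hFint := intervalIntegrable_of_eqOn_rpow_smul hα.1 hab hGcont hFG
  constructor
  · intro hctrl
    by_contra hW
    rw [isUnit_iff_isUnit_det, isUnit_iff_ne_zero, not_not] at hW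
    obtain ⟨x, hx, hWx⟩ := exists_mulVec_eq_zero_iff.2 hW
    let L : Matrix (Fin d) (Fin d) ℝ →ₗ[ℝ] ℝ :=
      { toFun := fun A => x ⬝ᵥ (A *ᵥ x)
        map_add' := fun A A' => by simp [add_mulVec]
        map_smul' := fun c A => by simp [smul_mulVec] }
    have hL := (LinearMap.toContinuousLinearMap L).intervalIntegral_comp_comm hFint
    have hLint : IntervalIntegrable (fun t => L (F t)) volume a b :=
      ⟨(LinearMap.toContinuousLinearMap L).integrable_comp hFint.1,
        (LinearMap.toContinuousLinearMap L).integrable_comp hFint.2⟩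
    have hLF : ∀ t, L (F t) =
        (b - t) ^ (1 - α) * (((Φ t * B)ᵀ *ᵥ x) ⬝ᵥ ((Φ t * B)ᵀ *ᵥ x)) := fun t => by
      rw [hgram, map_smul, smul_eq_mul, ← dotProduct_gram_mulVec]; rfl
    have hzero : ∫ t in a..b, L (F t) = 0 := by
      refine hL.trans ?_
      change x ⬝ᵥ ((∫ t in a..b, F t) *ᵥ x) = 0
      rw [hWx, dotProduct_zero]
    have hnonneg : 0 ≤ᵐ[volume.restrict (Set.Ioc a b)] fun t => L (F t) := by
      refine (ae_restrict_iff' measurableSet_Ioc).2 (.of_forall fun t ht => ?_)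
      change 0 ≤ L (F t)
      rw [hLF]
      exact mul_nonneg (Real.rpow_nonneg (sub_nonneg.2 ht.2) _)
        (Finset.sum_nonneg fun i _ => mul_self_nonneg _)
    rw [intervalIntegral.integral_eq_zero_iff_of_le_of_nonneg_ae hab.le hnonneg hLint] at hzero
    have hann : ∀ᵐ t ∂volume.restrict (Set.Ioc a b), (Φ t * B)ᵀ *ᵥ x = 0 := by
      rw [Filter.EventuallyEq, ae_restrict_iff' measurableSet_Ioc] at hzero
      rw [ae_restrict_iff' measurableSet_Ioc]
      filter_upwards [hzero, Measure.ae_ne volume b] with t h0 hb ht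
      have h1 := h0 ht
      rw [hLF] at h1
      have hpos : 0 < b - t := sub_pos.2 (lt_of_le_of_ne ht.2 hb)
      exact dotProduct_self_eq_zero.1
        ((mul_eq_zero.1 h1).resolve_left (Real.rpow_pos_of_pos hpos _).ne')
    obtain ⟨u, hu, hux⟩ := hctrl (WithLp.toLp 2 x)
    have huint : IntervalIntegrable (fun t => Matrix.toEuclideanLin (Φ t * B) (u t))
        volume a b := by
      refine intervalIntegrable_of_eqOn_rpow_smul hα.1 hab
        (g := fun t => Matrix.toEuclideanLin (Φe t * B) (u t)) ?_ ?_
      · rw [continuousOn_iff_continuous_domRestrict] at hΦe hu ⊢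
        exact (PiLp.continuous_toLp 2 _).comp ((hΦe.matrix_mul continuous_const).matrix_mulVec
          ((PiLp.continuous_ofLp 2 _).comp hu))
      · intro t ht
        simp only [hΦ t ht, Matrix.smul_mul, map_smul, LinearMap.smul_apply]
    have hinner := (innerSL ℝ (WithLp.toLp 2 x)).intervalIntegral_comp_comm huint
    have hinner0 : ∫ t in a..b,
        innerSL ℝ (WithLp.toLp 2 x) (Matrix.toEuclideanLin (Φ t * B) (u t)) = 0 := by
      rw [intervalIntegral.integral_of_le hab.le]
      refine integral_eq_zero_of_ae (hann.mono fun t ht => ?_)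
      simp only [innerSL_apply_apply, Pi.zero_apply, EuclideanSpace.inner_eq_star_dotProduct,
        star_trivial, toLpLin_apply]
      rw [dotProduct_comm, dotProduct_mulVec, ← mulVec_transpose, ht, zero_dotProduct]
    rw [hinner0, hux, innerSL_apply_apply] at hinner
    have hx0 := inner_self_eq_zero.1 hinner.symm
    exact hx (by simpa using hx0)
  · intro hW w
    set W := ∫ t in a..b, F t
    set y : Fin d → ℝ := W⁻¹ *ᵥ w.ofLp with hy
    refine ⟨fun t => WithLp.toLp 2 ((Φe t * B)ᵀ *ᵥ y), ?_, ?_⟩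
    · rw [continuousOn_iff_continuous_domRestrict] at hΦe ⊢
      exact (PiLp.continuous_toLp 2 _).comp
        ((hΦe.matrix_mul continuous_const).matrix_transpose.matrix_mulVec continuous_const)
    · let L : Matrix (Fin d) (Fin d) ℝ →ₗ[ℝ] EuclideanSpace ℝ (Fin d) :=
        (Matrix.toEuclideanLin (𝕜 := ℝ) (m := Fin d) (n := Fin d)).toLinearMap.flip
          (WithLp.toLp 2 y)
      have hL := (LinearMap.toContinuousLinearMap L).intervalIntegral_comp_comm hFint
      have hcongr : ∫ t in a..b,
          Matrix.toEuclideanLin (Φ t * B) (WithLp.toLp 2 ((Φe t * B)ᵀ *ᵥ y)) =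
          ∫ t in a..b, L (F t) := by
        rw [intervalIntegral.integral_of_le hab.le, intervalIntegral.integral_of_le hab.le]
        refine integral_congr_ae (ae_eq_of_eqOn_Ico fun t ht => ?_)
        rw [hgram, map_smul]
        change WithLp.toLp 2 ((Φ t * B) *ᵥ ((Φe t * B)ᵀ *ᵥ y)) =
          (b - t) ^ (1 - α) • WithLp.toLp 2 (((Φ t * B) * (Φ t * B)ᵀ) *ᵥ y)
        rw [hext t ht, Matrix.smul_mul, transpose_smul, smul_mulVec, mulVec_smul, mulVec_mulVec,
          WithLp.toLp_smul]
      refine hcongr.trans (hL.trans ?_)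
      change WithLp.toLp 2 (W *ᵥ y) = w
      rw [hy, mulVec_mulVec, mul_nonsing_inv _ ((isUnit_iff_isUnit_det _).1 hW), one_mulVec]
end

section
/- Let α ∈ (0,1), a < b reals, B a real d×N matrix, y₀, y_b ∈ ℝ^d, and let Φ : [a,b) → ℝ^{d×d} be such that t ↦ (b−t)^{1−α} Φ(t) extends to a continuous function on [a,b]. For z_b ∈ ℝ^d set z₀(z_b) = (1/Γ(1−α)) ∫_a^b (τ−a)^{−α} Φ(τ)ᵀ z_b dτ and J(z_b) = (1/2) ∫_a^b (b−t)^{1−α} ‖Bᵀ Φ(t)ᵀ z_b‖² dt − ⟨y_b, z_b⟩ + ⟨y₀, z₀(z_b)⟩. If ẑ_b is a global minimizer of J, then for every z_b ∈ ℝ^d one has ∫_a^b (b−t)^{1−α} ⟨Bᵀ Φ(t)ᵀ ẑ_b, Bᵀ Φ(t)ᵀ z_b⟩ dt + ⟨y₀, z₀(z_b)⟩ − ⟨y_b, z_b⟩ = 0; consequently the control u(t) = (b−t)^{1−α} Bᵀ Φ(t)ᵀ ẑ_b satisfies ∫_a^b Φ(t) B u(t) dt = y_b − Gᵀ y₀,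 where G = (1/Γ(1−α)) ∫_a^b (τ−a)^{−α} Φ(τ)ᵀ dτ. -/
open MeasureTheory Set Matrix
open scoped RealInnerProductSpace

attribute [local instance] Matrix.normedAddCommGroup Matrix.normedSpace

/-- A quadratic `s * l + s ^ 2 * q` with a minimum at `s = 0` has no linear term. -/
theorem linear_coeff_eq_zero_of_quadratic_nonneg {l q : ℝ}
    (h : ∀ s : ℝ, 0 ≤ s * l + s ^ 2 * q) : l = 0 := by
  have hder : HasDerivAt (fun s : ℝ => s * l + s ^ 2 * q) l 0 := by
    simpa using ((hasDerivAt_id' (0 : ℝ)).mul_const l).fun_add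
      (((hasDerivAt_id' (0 : ℝ)).fun_pow 2).mul_const q)
  have hloc : IsLocalMin (fun s : ℝ => s * l + s ^ 2 * q) 0 :=
    Filter.Eventually.of_forall fun s => by simpa using h s
  exact hloc.hasDerivAt_eq_zero hder

theorem intervalIntegrable_of_eq_smul_continuousOn {E : Type*} [NormedAddCommGroup E]
    [NormedSpace ℝ E] {a b : ℝ} (hab : a < b) {k : ℝ → ℝ} {f h : ℝ → E}
    (hk : IntervalIntegrable k volume a b) (hh : ContinuousOn h (Set.Icc a b))
    (hf : ∀ t ∈ Set.Ioo a b, f t = k t • h t) : IntervalIntegrable f volume a b := by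
  have hkh : IntervalIntegrable (fun t => k t • h t) volume a b :=
    hk.smul_continuousOn (by rwa [Set.uIcc_of_le hab.le])
  rw [intervalIntegrable_iff_integrableOn_Ioo_of_le hab.le] at hkh ⊢
  exact hkh.congr_fun (fun t ht => (hf t ht).symm) measurableSet_Ioo

theorem map_intervalIntegral_of_finiteDimensional {E F : Type*} [NormedAddCommGroup E]
    [NormedSpace ℝ E] [FiniteDimensional ℝ E] [NormedAddCommGroup F] [NormedSpace ℝ F]
    [CompleteSpace F] (L : E →ₗ[ℝ] F) {a b : ℝ} {f : ℝ → E}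
    (hf : IntervalIntegrable f volume a b) :
    L (∫ t in a..b, f t) = ∫ t in a..b, L (f t) :=
  haveI : CompleteSpace E := FiniteDimensional.complete ℝ E
  (L.toContinuousLinearMap.intervalIntegral_comp_comm hf).symm

theorem intervalIntegrable_sub_left_rpow {r : ℝ} (hr : -1 < r) (a b c : ℝ) :
    IntervalIntegrable (fun t => (c - t) ^ r) volume a b := by
  simpa using
    (intervalIntegral.intervalIntegrable_rpow' (a := c - a) (b := c - b) hr).comp_sub_left c

theorem intervalIntegrable_sub_right_rpow {r : ℝ} (hr : -1 < r) (a b c : ℝ) :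
    IntervalIntegrable (fun t => (t - c) ^ r) volume a b := by
  simpa using
    (intervalIntegral.intervalIntegrable_rpow' (a := a - c) (b := b - c) hr).comp_sub_right c

/-- Integrability of the Beta kernel on `[a, b]`. -/
theorem intervalIntegrable_rpow_mul_rpow {r s a b : ℝ} (hr : -1 < r) (hs : -1 < s)
    (hab : a < b) :
    IntervalIntegrable (fun t => (t - a) ^ r * (b - t) ^ s) volume a b := by
  have hac : a < (a + b) / 2 := by linarith
  have hcb : (a + b) / 2 < b := by linarith
  refine IntervalIntegrable.trans (b := (a + b) / 2) ?_ ?_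
  · refine (intervalIntegrable_sub_right_rpow hr _ _ a).mul_continuousOn ?_
    rw [Set.uIcc_of_le hac.le]
    exact ContinuousOn.rpow_const (by fun_prop) fun t ht => Or.inl (by linarith [ht.2])
  · refine (intervalIntegrable_sub_left_rpow hs _ _ b).continuousOn_mul ?_
    rw [Set.uIcc_of_le hcb.le]
    exact ContinuousOn.rpow_const (by fun_prop) fun t ht => Or.inl (by linarith [ht.1])

theorem continuous_toEuclideanLin_apply {X : Type*} [TopologicalSpace X] {m n : ℕ}
    {M : X → Matrix (Fin m) (Fin n) ℝ} {v : X → EuclideanSpace ℝ (Fin n)}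
    {s : Set X} (hM : ContinuousOn M s) (hv : ContinuousOn v s) :
    ContinuousOn (fun x => Matrix.toEuclideanLin (M x) (v x)) s := by
  rw [continuousOn_iff_continuous_domRestrict] at *
  have : Continuous fun x : s => WithLp.toLp 2 (M x *ᵥ WithLp.ofLp (v x)) :=
    (PiLp.continuous_toLp 2 _).comp
      (Continuous.matrix_mulVec hM ((PiLp.continuous_ofLp 2 _).comp hv))
  exact this

theorem inner_toEuclideanLin_left {m n : ℕ} (M : Matrix (Fin m) (Fin n) ℝ)
    (x : EuclideanSpace ℝ (Fin n)) (y : EuclideanSpace ℝ (Fin m)) :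
    ⟪Matrix.toEuclideanLin M x, y⟫ = ⟪x, Matrix.toEuclideanLin Mᵀ y⟫ := by
  rw [← Matrix.conjTranspose_eq_transpose_of_trivial,
    Matrix.toEuclideanLin_conjTranspose_eq_adjoint, LinearMap.adjoint_inner_right]

/-- Euler–Lagrange condition at a minimizer `ẑ_b` of the quadratic
functional `J`, and the resulting identity for the optimal control
`u(t) = (b-t)^{1-α} Bᵀ Φ(t)ᵀ ẑ_b`:  `∫_a^b Φ(t) B u(t) dt = y_b - Gᵀ y₀`. -/
theorem minimizer_euler_lagrange_and_control
    (d N : ℕ) (α a b : ℝ) (hα : α ∈ Set.Ioo (0:ℝ) 1) (hab : a < b)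
    (B : Matrix (Fin d) (Fin N) ℝ) (y₀ yb : EuclideanSpace ℝ (Fin d))
    (Φ : ℝ → Matrix (Fin d) (Fin d) ℝ)
    (Φe : ℝ → Matrix (Fin d) (Fin d) ℝ) (hΦe : ContinuousOn Φe (Set.Icc a b))
    (hext : ∀ t ∈ Set.Ico a b, Φe t = (b - t) ^ (1 - α) • Φ t)
    (z0 : EuclideanSpace ℝ (Fin d) → EuclideanSpace ℝ (Fin d))
    (hz0 : ∀ zb, z0 zb = (1 / Real.Gamma (1 - α)) •
      ∫ τ in a..b, (τ - a) ^ (-α) • Matrix.toEuclideanLin (Φ τ)ᵀ zb)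
    (J : EuclideanSpace ℝ (Fin d) → ℝ)
    (hJ : ∀ zb, J zb = (1 / 2) *
        (∫ t in a..b, (b - t) ^ (1 - α) * ‖Matrix.toEuclideanLin (Bᵀ * (Φ t)ᵀ) zb‖ ^ 2)
      - ⟪yb, zb⟫ + ⟪y₀, z0 zb⟫)
    (zhat : EuclideanSpace ℝ (Fin d)) (hmin : ∀ zb, J zhat ≤ J zb)
    (G : Matrix (Fin d) (Fin d) ℝ)
    (hG : G = (1 / Real.Gamma (1 - α)) • ∫ τ in a..b, (τ - a) ^ (-α) • (Φ τ)ᵀ) :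
    (∀ zb : EuclideanSpace ℝ (Fin d),
      (∫ t in a..b, (b - t) ^ (1 - α) *
        ⟪Matrix.toEuclideanLin (Bᵀ * (Φ t)ᵀ) zhat, Matrix.toEuclideanLin (Bᵀ * (Φ t)ᵀ) zb⟫)
      + ⟪y₀, z0 zb⟫ - ⟪yb, zb⟫ = 0) ∧
    (∫ t in a..b, Matrix.toEuclideanLin (Φ t * B)
        ((b - t) ^ (1 - α) • Matrix.toEuclideanLin (Bᵀ * (Φ t)ᵀ) zhat))
      = yb - Matrix.toEuclideanLin Gᵀ y₀ := by
  obtain ⟨hα0, hα1⟩ := hα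
  have hker : IntervalIntegrable (fun t => (b - t) ^ (α - 1)) volume a b :=
    intervalIntegrable_sub_left_rpow (by linarith) _ _ _
  have hbeta : IntervalIntegrable (fun t => (t - a) ^ (-α) * (b - t) ^ (α - 1)) volume a b :=
    intervalIntegrable_rpow_mul_rpow (by linarith) (by linarith) hab
  have hΦ : ∀ t ∈ Set.Ioo a b, Φ t = (b - t) ^ (α - 1) • Φe t := fun t ht => by
    rw [hext t ⟨ht.1.le, ht.2⟩, smul_smul, ← Real.rpow_add (sub_pos.2 ht.2)]
    simp
  have hpow : ∀ t ∈ Set.Ioo a b,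
      (b - t) ^ (1 - α) * ((b - t) ^ (α - 1) * (b - t) ^ (α - 1)) = (b - t) ^ (α - 1) :=
    fun t ht => by
      rw [← Real.rpow_add (sub_pos.2 ht.2), ← Real.rpow_add (sub_pos.2 ht.2)]
      congr 1; ring
  have hΦeT : ContinuousOn (fun t => (Φe t)ᵀ) (Set.Icc a b) :=
    (continuous_id.matrix_transpose).comp_continuousOn hΦe
  have hBΦe : ContinuousOn (fun t => Bᵀ * (Φe t)ᵀ) (Set.Icc a b) :=
    (continuous_const.matrix_mul continuous_id).comp_continuousOn hΦeT
  have hΦeB : ContinuousOn (fun t => Φe t * B) (Set.Icc a b) :=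
    (continuous_id.matrix_mul continuous_const).comp_continuousOn hΦe
  have hS : ∀ x, ContinuousOn (fun t => Matrix.toEuclideanLin (Bᵀ * (Φe t)ᵀ) x) (Set.Icc a b) :=
    fun x => continuous_toEuclideanLin_apply hBΦe continuousOn_const
  have hquad : ∀ x y, IntervalIntegrable (fun t => (b - t) ^ (1 - α) *
      ⟪Matrix.toEuclideanLin (Bᵀ * (Φ t)ᵀ) x, Matrix.toEuclideanLin (Bᵀ * (Φ t)ᵀ) y⟫)
      volume a b := fun x y =>
    intervalIntegrable_of_eq_smul_continuousOn hab hker (ContinuousOn.inner (hS x) (hS y)) fun t ht => by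
      rw [smul_eq_mul, ← congrArg (· * _) (hpow t ht)]
      simp only [hΦ t ht, Matrix.transpose_smul, Matrix.mul_smul, map_smul, LinearMap.smul_apply,
        real_inner_smul_left, real_inner_smul_right]
      ring
  have hGint := intervalIntegrable_of_eq_smul_continuousOn
    (f := fun τ => (τ - a) ^ (-α) • (Φ τ)ᵀ) hab hbeta hΦeT fun t ht => by
      rw [hΦ t ht, Matrix.transpose_smul, smul_smul]
  have hF : IntervalIntegrable (fun t => Matrix.toEuclideanLin (Φ t * B)
      ((b - t) ^ (1 - α) • Matrix.toEuclideanLin (Bᵀ * (Φ t)ᵀ) zhat)) volume a b :=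
    intervalIntegrable_of_eq_smul_continuousOn hab hker
      (continuous_toEuclideanLin_apply hΦeB (hS zhat)) fun t ht => by
      conv_rhs => rw [← hpow t ht]
      simp only [hΦ t ht, Matrix.transpose_smul, Matrix.mul_smul, Matrix.smul_mul, map_smul,
        LinearMap.smul_apply, smul_smul]
      congr 1; ring
  have hz0G : ∀ x, z0 x = Matrix.toEuclideanLin G x := fun x => by
    have hcomm := map_intervalIntegral_of_finiteDimensional
      ((LinearMap.applyₗ x).comp (Matrix.toEuclideanLin (𝕜 := ℝ) (m := Fin d)
        (n := Fin d)).toLinearMap) hGint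
    simp only [LinearMap.comp_apply, LinearEquiv.coe_coe, LinearMap.applyₗ_apply_apply,
      map_smul] at hcomm
    rw [hz0, hG, map_smul, LinearMap.smul_apply, hcomm]
  set Q : EuclideanSpace ℝ (Fin d) → EuclideanSpace ℝ (Fin d) → ℝ := fun x y =>
    ∫ t in a..b, (b - t) ^ (1 - α) *
      ⟪Matrix.toEuclideanLin (Bᵀ * (Φ t)ᵀ) x, Matrix.toEuclideanLin (Bᵀ * (Φ t)ᵀ) y⟫ with hQ
  have hJQ : ∀ x, J x = 1 / 2 * Q x x - ⟪yb, x⟫ + ⟪y₀, z0 x⟫ := fun x => by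
    simp only [hJ, hQ, real_inner_self_eq_norm_sq]
  have hQadd : ∀ x y (s : ℝ), Q (x + s • y) (x + s • y) =
      Q x x + 2 * s * Q x y + s ^ 2 * Q y y := fun x y s => by
    simp only [hQ]
    rw [← intervalIntegral.integral_const_mul, ← intervalIntegral.integral_const_mul,
      ← intervalIntegral.integral_add (hquad x x) ((hquad x y).const_mul _),
      ← intervalIntegral.integral_add ((hquad x x).add ((hquad x y).const_mul _))
        ((hquad y y).const_mul _)]
    refine intervalIntegral.integral_congr fun t _ => ?_
    simp only [map_add, map_smul, inner_add_left, inner_add_right, real_inner_smul_left,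
      real_inner_smul_right]
    rw [real_inner_comm (Matrix.toEuclideanLin (Bᵀ * (Φ t)ᵀ) x)
      (Matrix.toEuclideanLin (Bᵀ * (Φ t)ᵀ) y)]
    ring
  have hEL : ∀ z, Q zhat z + ⟪y₀, z0 z⟫ - ⟪yb, z⟫ = 0 := fun z => by
    refine linear_coeff_eq_zero_of_quadratic_nonneg (q := 1 / 2 * Q z z) fun s => ?_
    have := hmin (zhat + s • z)
    rw [hJQ, hJQ, hQadd] at this
    simp only [hz0G, map_add, map_smul, inner_add_right, real_inner_smul_right] at this ⊢
    linarith
  refine ⟨hEL, ext_inner_right ℝ fun z => ?_⟩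
  have hinner : ⟪∫ t in a..b, Matrix.toEuclideanLin (Φ t * B)
      ((b - t) ^ (1 - α) • Matrix.toEuclideanLin (Bᵀ * (Φ t)ᵀ) zhat), z⟫ = Q zhat z := by
    rw [real_inner_comm, ← innerSL_apply_apply ℝ z,
      ← (innerSL ℝ z).intervalIntegral_comp_comm hF]
    refine intervalIntegral.integral_congr fun t _ => ?_
    simp only [innerSL_apply_apply]
    rw [real_inner_comm, inner_toEuclideanLin_left, Matrix.transpose_mul, real_inner_smul_left]
  rw [hinner, inner_sub_left, inner_toEuclideanLin_left, Matrix.transpose_transpose, ← hz0G]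
  linarith [hEL z]
end
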